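/- The obstruction complex of a grid is a chain complex (mod 2 version of the paper's lemma): for n ≥ 2, let CD_k be the 𝔽₂-vector space with basis the triples (x, y, D) where x, y are grid states of the toroidal grid of size n and D is a positive domain from x to y with μ(D) = k, and define ∂(x, y, D) = Σ (w, y, E) + Σ (x, w, E), where the first sum is over all triples (w, R, E) with R an empty rectangle from x to w, E a positive domain from w to y, and R + E = D, and the second sum is over all triples (w, E, R) with E a positive domain from x to w, R an empty rectangle from w to y, and E + R = D. Then ∂ maps CD_k to CD_{k−1}, and ∂ ∘ ∂ = 0, so (CD_*, ∂) is a chain complex over 𝔽₂. -/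

import Mathlib

/-- `D : (ℤ/n)² → ℤ` is a domain from the grid state `σ` to the grid state `τ`:
for all `(i,j)`, `D(i,j) − D(i−1,j) − D(i,j−1) + D(i−1,j−1) = 𝟙[j = σ i] − 𝟙[j = τ i]`. -/
def IsGridDomain (n : ℕ) (σ τ : Equiv.Perm (ZMod n)) (D : ZMod n → ZMod n → ℤ) : Prop :=
  ∀ i j : ZMod n,
    D i j - D (i - 1) j - D i (j - 1) + D (i - 1) (j - 1) =
      (if j = σ i then 1 else 0) - (if j = τ i then 1 else 0)

/-- The point measure of `D` at the point `(i,j)`: the average of the values of `D`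
on the four squares meeting at `(i,j)`. -/
def ptMeasure (n : ℕ) (D : ZMod n → ZMod n → ℤ) (i j : ZMod n) : ℚ :=
  ((D i j + D (i - 1) j + D i (j - 1) + D (i - 1) (j - 1) : ℤ) : ℚ) / 4

/-- The Maslov index of a domain `D` from `σ` to `τ`: the sum of the point measures of
`D` at all points of `σ` and all points of `τ`. -/
def maslov (n : ℕ) [NeZero n] (σ τ : Equiv.Perm (ZMod n))
    (D : ZMod n → ZMod n → ℤ) : ℚ :=
  (∑ i : ZMod n, ptMeasure n D i (σ i)) + ∑ i : ZMod n, ptMeasure n D i (τ i)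

/-- A cyclic interval `{a, a+1, …, a+k}` in `ℤ/n` (nonempty by construction). -/
def IsCyclicInterval (n : ℕ) (S : Set (ZMod n)) : Prop :=
  ∃ (a : ZMod n) (k : ℕ), S = {b | ∃ m : ℕ, m ≤ k ∧ b = a + (m : ZMod n)}

/-- A rectangle from `σ` to `τ`: a domain from `σ` to `τ` which is the indicator
function of a product `I × J` of nonempty proper cyclic intervals in `ℤ/n`. -/
def IsRectangle (n : ℕ) (σ τ : Equiv.Perm (ZMod n)) (D : ZMod n → ZMod n → ℤ) : Prop :=
  IsGridDomain n σ τ D ∧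
    ∃ I J : Set (ZMod n),
      IsCyclicInterval n I ∧ IsCyclicInterval n J ∧ I ≠ Set.univ ∧ J ≠ Set.univ ∧
      ∀ i j : ZMod n, D i j = (I ×ˢ J).indicator 1 (i, j)

/-- The point `(i,j)` lies in the interior of the rectangle `D`: all four squares
`(i,j)`, `(i−1,j)`, `(i,j−1)`, `(i−1,j−1)` lie in the product `I × J`, i.e. `D` takes
the value `1` on all four of them. -/
def InInterior (n : ℕ) (D : ZMod n → ZMod n → ℤ) (i j : ZMod n) : Prop :=
  D i j = 1 ∧ D (i - 1) j = 1 ∧ D i (j - 1) = 1 ∧ D (i - 1) (j - 1) = 1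

/-- An empty rectangle from `σ` to `τ`: a rectangle containing no point of `σ` in its
interior. -/
def IsEmptyRectangle (n : ℕ) (σ τ : Equiv.Perm (ZMod n))
    (D : ZMod n → ZMod n → ℤ) : Prop :=
  IsRectangle n σ τ D ∧ ∀ i : ZMod n, ¬ InInterior n D i (σ i)

/-- A generator of the obstruction complex: a triple `(x, y, D)` with `x, y` grid
states and `D` a positive domain from `x` to `y`. -/
structure ObGen (n : ℕ) where
  x : Equiv.Perm (ZMod n)
  y : Equiv.Perm (ZMod n)
  D : ZMod n → ZMod n → ℤ
  isDomain : IsGridDomain n x y D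
  pos : ∀ i j, 0 ≤ D i j

/-- The strict cyclic order on `ℤ/n`. -/
def CycLt {n : ℕ} (a b c : ZMod n) : Prop :=
  (a.val < b.val ∧ b.val < c.val) ∨ (b.val < c.val ∧ c.val < a.val) ∨
    (c.val < a.val ∧ a.val < b.val)

instance {n : ℕ} (a b c : ZMod n) : Decidable (CycLt a b c) := by
  unfold CycLt; infer_instance

/-- The indicator function of the half-open cyclic interval from `a` to `b`, for `a ≠ b`. -/
def arcInd {n : ℕ} (a b i : ZMod n) : ℤ :=
  if i = a ∨ CycLt a i b then 1 else 0

section CyclicOrder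

variable {n : ℕ}

theorem CycLt.rotate {a b c : ZMod n} (h : CycLt a b c) : CycLt b c a := by
  unfold CycLt at *; omega

theorem CycLt.asymm {a b c : ZMod n} (h : CycLt a b c) : ¬ CycLt a c b := by
  unfold CycLt at *; omega

theorem CycLt.ne {a b c : ZMod n} (h : CycLt a b c) : a ≠ b ∧ b ≠ c ∧ a ≠ c := by
  unfold CycLt at h
  refine ⟨?_, ?_, ?_⟩ <;> rintro rfl <;> omega

theorem arcInd_eq_zero_or_one (a b i : ZMod n) : arcInd a b i = 0 ∨ arcInd a b i = 1 := by
  unfold arcInd; split_ifs <;> simp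

theorem arcInd_nonneg (a b i : ZMod n) : 0 ≤ arcInd a b i := by
  unfold arcInd; split_ifs <;> simp

@[simp] theorem arcInd_left (a b : ZMod n) : arcInd a b a = 1 := by simp [arcInd]

theorem arcInd_right {a b : ZMod n} (hab : a ≠ b) : arcInd a b b = 0 := by
  have := @CycLt.ne n a b b
  simp [arcInd, hab.symm]; grind

theorem arcInd_eq_one_iff {a b i : ZMod n} : arcInd a b i = 1 ↔ i = a ∨ CycLt a i b := by
  unfold arcInd; split_ifs <;> simp_all

variable [NeZero n]

theorem cycLt_total {a b c : ZMod n} (hab : a ≠ b) (hbc : b ≠ c) (hac : a ≠ c) :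
    CycLt a b c ∨ CycLt a c b := by
  have h1 := (ZMod.val_injective n).ne hab
  have h2 := (ZMod.val_injective n).ne hbc
  have h3 := (ZMod.val_injective n).ne hac
  unfold CycLt; omega

theorem CycLt.split {a b c : ZMod n} (h : CycLt a b c) (i : ZMod n) :
    CycLt a i c ↔ CycLt a i b ∨ i = b ∨ CycLt b i c := by
  have := (ZMod.val_injective n).eq_iff (a := i) (b := b)
  rw [← this]
  unfold CycLt at *; omega

theorem CycLt.separate {a b c d : ZMod n} (h : CycLt a b c) (h' : ¬ CycLt a d c) (hda : d ≠ a)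
    (hdc : d ≠ c) : CycLt b c d ∧ CycLt d a b := by
  have h1 := (ZMod.val_injective n).ne hda
  have h2 := (ZMod.val_injective n).ne hdc
  unfold CycLt at *; omega

theorem arcInd_add {a b c : ZMod n} (h : CycLt a b c) (i : ZMod n) :
    arcInd a c i = arcInd a b i + arcInd b c i := by
  have h1 := (ZMod.val_injective n).eq_iff (a := i) (b := b)
  have h2 := (ZMod.val_injective n).eq_iff (a := i) (b := a)
  have e1 := arcInd_eq_one_iff (a := a) (b := c) (i := i)
  have e2 := arcInd_eq_one_iff (a := a) (b := b) (i := i)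
  have e3 := arcInd_eq_one_iff (a := b) (b := c) (i := i)
  have z1 := arcInd_eq_zero_or_one a c i
  have z2 := arcInd_eq_zero_or_one a b i
  have z3 := arcInd_eq_zero_or_one b c i
  rw [← h1] at e3
  rw [← h2] at e1 e2
  unfold CycLt at *
  omega

theorem arcInd_add_symm {a b : ZMod n} (hab : a ≠ b) (i : ZMod n) :
    arcInd a b i + arcInd b a i = 1 := by
  have h0 := (ZMod.val_injective n).ne hab
  have h1 := (ZMod.val_injective n).eq_iff (a := i) (b := b)
  have h2 := (ZMod.val_injective n).eq_iff (a := i) (b := a)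
  have e2 := arcInd_eq_one_iff (a := a) (b := b) (i := i)
  have e3 := arcInd_eq_one_iff (a := b) (b := a) (i := i)
  have z2 := arcInd_eq_zero_or_one a b i
  have z3 := arcInd_eq_zero_or_one b a i
  rw [← h1] at e3
  rw [← h2] at e2
  unfold CycLt at *
  omega

theorem ZMod.val_sub_eq_ite (a b : ZMod n) :
    (a - b).val = if b.val ≤ a.val then a.val - b.val else n + a.val - b.val := by
  split_ifs with h
  · exact ZMod.val_sub h
  · have hb : b ≠ 0 := by
      rintro rfl
      simp at h
    have : NeZero b := ⟨hb⟩
    have hlt := ZMod.val_lt b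
    rw [sub_eq_add_neg, ZMod.val_add_of_lt] <;> rw [ZMod.val_neg_of_ne_zero] <;> omega

theorem mem_arc_iff {a b : ZMod n} (hab : a ≠ b) (i : ZMod n) :
    (i = a ∨ CycLt a i b) ↔ (i - a).val < (b - a).val := by
  have h0 := (ZMod.val_injective n).ne hab
  have h1 := (ZMod.val_injective n).eq_iff (a := i) (b := a)
  have ha := ZMod.val_lt a
  have hb := ZMod.val_lt b
  have hi := ZMod.val_lt i
  rw [← h1, ZMod.val_sub_eq_ite, ZMod.val_sub_eq_ite]
  unfold CycLt
  split_ifs <;> omega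

theorem two_le_of_ne {a b : ZMod n} (hab : a ≠ b) : 2 ≤ n := by
  by_contra h
  have h0 := NeZero.ne n
  obtain rfl : n = 1 := by omega
  exact hab (Subsingleton.elim a b)

theorem sub_one_mem_arc_iff {a b : ZMod n} (hab : a ≠ b) (i : ZMod n) :
    (i - 1 = a ∨ CycLt a (i - 1) b) ↔ (i = b ∨ CycLt a i b) := by
  have h0 := (ZMod.val_injective n).ne hab
  have hn := two_le_of_ne hab
  have h1 := (ZMod.val_injective n).eq_iff (a := i - 1) (b := a)
  have h2 := (ZMod.val_injective n).eq_iff (a := i) (b := b)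
  have h3 : (i - 1).val = if 1 ≤ i.val then i.val - 1 else n + i.val - 1 := by
    have := ZMod.val_sub_eq_ite i 1
    rwa [ZMod.val_one'' (by omega)] at this
  have ha := ZMod.val_lt a
  have hb := ZMod.val_lt b
  have hi := ZMod.val_lt i
  rw [← h1, ← h2]
  unfold CycLt
  rw [h3]
  split_ifs <;> omega

theorem arcInd_sub_arcInd {a b : ZMod n} (hab : a ≠ b) (i : ZMod n) :
    arcInd a b i - arcInd a b (i - 1) = (if i = a then 1 else 0) - if i = b then 1 else 0 := by
  have h := sub_one_mem_arc_iff hab i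
  have hne := @CycLt.ne n a i b
  rw [← arcInd_eq_one_iff] at h
  have e := arcInd_eq_one_iff (a := a) (b := b) (i := i)
  have z1 := arcInd_eq_zero_or_one a b i
  have z2 := arcInd_eq_zero_or_one a b (i - 1)
  grind

theorem arcInd_add_arcInd {a b : ZMod n} (hab : a ≠ b) (i : ZMod n) :
    arcInd a b i + arcInd a b (i - 1) =
      2 * (if CycLt a i b then 1 else 0) + (if i = a then 1 else 0) + if i = b then 1 else 0 := by
  have h := sub_one_mem_arc_iff hab i
  have hne := @CycLt.ne n a i b
  rw [← arcInd_eq_one_iff] at h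
  have e := arcInd_eq_one_iff (a := a) (b := b) (i := i)
  have z1 := arcInd_eq_zero_or_one a b i
  have z2 := arcInd_eq_zero_or_one a b (i - 1)
  grind

theorem arcInd_injective {a b c d : ZMod n} (hab : a ≠ b) (hcd : c ≠ d)
    (h : ∀ i, arcInd a b i = arcInd c d i) : a = c ∧ b = d := by
  have h' : ∀ i : ZMod n, ((if i = a then 1 else 0) - if i = b then 1 else 0 : ℤ) =
      (if i = c then 1 else 0) - if i = d then 1 else 0 := fun i ↦ by
    rw [← arcInd_sub_arcInd hab, ← arcInd_sub_arcInd hcd, h, h]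
  have h1 := h' a
  have h2 := h' b
  grind

theorem arcInd_eq_one_and {a b : ZMod n} (hab : a ≠ b) (i : ZMod n) :
    (arcInd a b i = 1 ∧ arcInd a b (i - 1) = 1) ↔ CycLt a i b := by
  have h := sub_one_mem_arc_iff hab i
  have hne := @CycLt.ne n a i b
  rw [← arcInd_eq_one_iff] at h
  have e := arcInd_eq_one_iff (a := a) (b := b) (i := i)
  have z1 := arcInd_eq_zero_or_one a b i
  have z2 := arcInd_eq_zero_or_one a b (i - 1)
  grind

theorem isCyclicInterval_arc {a b : ZMod n} (hab : a ≠ b) :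
    IsCyclicInterval n {i | arcInd a b i = 1} := by
  have hpos : 0 < (b - a).val := by
    rw [ZMod.val_pos]; exact sub_ne_zero.2 hab.symm
  refine ⟨a, (b - a).val - 1, ?_⟩
  ext i
  have : arcInd a b i = 1 ↔ (i = a ∨ CycLt a i b) := arcInd_eq_one_iff
  simp only [Set.mem_ofPred_eq, this, mem_arc_iff hab]
  constructor
  · intro h
    exact ⟨(i - a).val, by omega, by simp⟩
  · rintro ⟨m, hm, rfl⟩
    have := ZMod.val_lt (b - a)
    rw [add_sub_cancel_left, ZMod.val_natCast_of_lt] <;> omega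

theorem IsCyclicInterval.exists_arc {S : Set (ZMod n)} (hS : IsCyclicInterval n S)
    (hS' : S ≠ Set.univ) : ∃ a b : ZMod n, a ≠ b ∧ ∀ i, i ∈ S ↔ arcInd a b i = 1 := by
  obtain ⟨a, k, rfl⟩ := hS
  have hk : k + 1 < n := by
    by_contra hk
    refine hS' (Set.eq_univ_of_forall fun i ↦ ⟨(i - a).val, ?_, by simp⟩)
    have := ZMod.val_lt (i - a)
    omega
  have hv : (a + ((k + 1 : ℕ) : ZMod n) - a).val = k + 1 := by
    rw [add_sub_cancel_left, ZMod.val_natCast_of_lt hk]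
  have hab : a ≠ a + ((k + 1 : ℕ) : ZMod n) := by
    intro h
    rw [← h] at hv
    simp at hv
  refine ⟨a, _, hab, fun i ↦ ?_⟩
  have : arcInd a (a + ((k + 1 : ℕ) : ZMod n)) i = 1 ↔
    (i = a ∨ CycLt a i (a + ((k + 1 : ℕ) : ZMod n))) := arcInd_eq_one_iff
  rw [this, mem_arc_iff hab, hv]
  constructor
  · rintro ⟨m, hm, rfl⟩
    rw [add_sub_cancel_left, ZMod.val_natCast_of_lt] <;> omega
  · intro h
    exact ⟨(i - a).val, by omega, by simp⟩

end CyclicOrder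

section Rectangles

variable {n : ℕ}

/-- The indicator function of the rectangle with lower left corner `(a, x a)` and upper right
corner `(b, x b)`. -/
def cornerRect (x : Equiv.Perm (ZMod n)) (a b i j : ZMod n) : ℤ :=
  arcInd a b i * arcInd (x a) (x b) j

/-- The rectangle with lower left corner `(a, x a)` and upper right corner `(b, x b)` is
nondegenerate and has no point of `x` in its interior. -/
def IsEmptyCorner (x : Equiv.Perm (ZMod n)) (a b : ZMod n) : Prop :=
  a ≠ b ∧ ∀ i, CycLt a i b → ¬ CycLt (x a) (x i) (x b)

variable [NeZero n]

omit [NeZero n] in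
theorem cornerRect_nonneg (x : Equiv.Perm (ZMod n)) (a b i j : ZMod n) :
    0 ≤ cornerRect x a b i j :=
  mul_nonneg (arcInd_nonneg ..) (arcInd_nonneg ..)

theorem isGridDomain_cornerRect (x : Equiv.Perm (ZMod n)) {a b : ZMod n} (hab : a ≠ b) :
    IsGridDomain n x (x * Equiv.swap a b) (cornerRect x a b) := by
  intro i j
  have h1 := arcInd_sub_arcInd hab i
  have h2 := arcInd_sub_arcInd (x.injective.ne hab) j
  have : cornerRect x a b i j - cornerRect x a b (i - 1) j - cornerRect x a b i (j - 1) +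
      cornerRect x a b (i - 1) (j - 1) = (arcInd a b i - arcInd a b (i - 1)) *
        (arcInd (x a) (x b) j - arcInd (x a) (x b) (j - 1)) := by
    unfold cornerRect; ring
  rw [this, h1, h2, Equiv.Perm.mul_apply]
  have hx := x.injective.ne hab
  by_cases hia : i = a
  · subst hia; simp [hab]
  by_cases hib : i = b
  · subst hib; simp [hab.symm]
  · simp [hia, hib, Equiv.swap_apply_of_ne_of_ne hia hib]

theorem isRectangle_iff {x w : Equiv.Perm (ZMod n)} {D : ZMod n → ZMod n → ℤ} :
    IsRectangle n x w D ↔ ∃ a b, a ≠ b ∧ w = x * Equiv.swap a b ∧ D = cornerRect x a b := by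
  constructor
  · rintro ⟨hD, I, J, hI, hJ, hI', hJ', h⟩
    obtain ⟨a, b, hab, hI⟩ := hI.exists_arc hI'
    obtain ⟨c, d, hcd, hJ⟩ := hJ.exists_arc hJ'
    have hD' : ∀ i j, D i j = arcInd a b i * arcInd c d j := by
      intro i j
      rw [h]
      have h1 := hI i
      have h2 := hJ j
      rcases arcInd_eq_zero_or_one a b i with h3 | h3 <;>
        rcases arcInd_eq_zero_or_one c d j with h4 | h4 <;>
        simp_all [Set.indicator]
    have key : ∀ i j, ((if i = a then 1 else 0) - if i = b then 1 else 0 : ℤ) *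
        ((if j = c then 1 else 0) - if j = d then 1 else 0) =
        (if j = x i then 1 else 0) - if j = w i then 1 else 0 := by
      intro i j
      rw [← hD i j, ← arcInd_sub_arcInd hab, ← arcInd_sub_arcInd hcd]
      simp only [hD']
      ring
    have h1 : x a = c := by have := key a c; grind
    have h2 : x b = d := by have := key b d; grind
    have h3 : w a = d := by have := key a d; grind
    have h4 : w b = c := by have := key b c; grind
    subst h1 h2
    refine ⟨a, b, hab, ?_, by ext i j; exact hD' i j⟩
    ext1 i
    rw [Equiv.Perm.mul_apply]
    by_cases hia : i = a
    · subst hia; simpa using h3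
    by_cases hib : i = b
    · subst hib; simpa using h4
    rw [Equiv.swap_apply_of_ne_of_ne hia hib]
    have := key i (x i)
    grind
  · rintro ⟨a, b, hab, rfl, rfl⟩
    have hx := x.injective.ne hab
    refine ⟨isGridDomain_cornerRect x hab, {i | arcInd a b i = 1},
      {j | arcInd (x a) (x b) j = 1}, isCyclicInterval_arc hab,
      isCyclicInterval_arc hx, ?_, ?_, ?_⟩
    · intro h
      have : b ∈ {i | arcInd a b i = 1} := h ▸ Set.mem_univ b
      simp [arcInd_right hab] at this
    · intro h
      have : x b ∈ {i | arcInd (x a) (x b) i = 1} := h ▸ Set.mem_univ (x b)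
      simp [arcInd_right hx] at this
    · intro i j
      unfold cornerRect
      rcases arcInd_eq_zero_or_one a b i with h3 | h3 <;>
        rcases arcInd_eq_zero_or_one (x a) (x b) j with h4 | h4 <;>
        simp [Set.indicator, h3, h4]

theorem inInterior_cornerRect_iff {x : Equiv.Perm (ZMod n)} {a b : ZMod n} (hab : a ≠ b)
    (i j : ZMod n) :
    InInterior n (cornerRect x a b) i j ↔ CycLt a i b ∧ CycLt (x a) j (x b) := by
  rw [← arcInd_eq_one_and hab, ← arcInd_eq_one_and (x.injective.ne hab)]
  unfold InInterior cornerRect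
  rcases arcInd_eq_zero_or_one a b i with h1 | h1 <;>
    rcases arcInd_eq_zero_or_one (x a) (x b) j with h2 | h2 <;>
    rcases arcInd_eq_zero_or_one a b (i - 1) with h3 | h3 <;>
    rcases arcInd_eq_zero_or_one (x a) (x b) (j - 1) with h4 | h4 <;>
    simp [h1, h2, h3, h4]

theorem isEmptyRectangle_iff {x w : Equiv.Perm (ZMod n)} {D : ZMod n → ZMod n → ℤ} :
    IsEmptyRectangle n x w D ↔
      ∃ a b, IsEmptyCorner x a b ∧ w = x * Equiv.swap a b ∧ D = cornerRect x a b := by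
  unfold IsEmptyRectangle
  rw [isRectangle_iff]
  constructor
  · rintro ⟨⟨a, b, hab, hw, rfl⟩, h⟩
    refine ⟨a, b, ⟨hab, fun i h1 h2 ↦ h i ?_⟩, hw, rfl⟩
    exact (inInterior_cornerRect_iff hab ..).2 ⟨h1, h2⟩
  · rintro ⟨a, b, ⟨hab, h⟩, hw, rfl⟩
    refine ⟨⟨a, b, hab, hw, rfl⟩, fun i hi ↦ ?_⟩
    obtain ⟨h1, h2⟩ := (inInterior_cornerRect_iff hab ..).1 hi
    exact h i h1 h2

theorem cornerRect_injective {x : Equiv.Perm (ZMod n)} {a b c d : ZMod n} (hab : a ≠ b)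
    (hcd : c ≠ d) (h : cornerRect x a b = cornerRect x c d) : a = c ∧ b = d := by
  have h1 : ∀ i, arcInd a b i = arcInd c d i * arcInd (x c) (x d) (x a) := by
    intro i
    simpa [cornerRect] using congrFun (congrFun h i) (x a)
  refine arcInd_injective hab hcd fun i ↦ ?_
  have h2 := h1 a
  rw [arcInd_left] at h2
  rcases arcInd_eq_zero_or_one (x c) (x d) (x a) with h3 | h3
  · simp [h3] at h2
  · rw [h1, h3, mul_one]

end Rectangles

section Decompositions

variable {n : ℕ} [NeZero n]

/-- Two consecutive empty rectangles: one with corners over `a`, `b` starting at `x`, and one with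
corners over `c`, `d` starting at the target of the first. -/
def IsEmptyChain (x : Equiv.Perm (ZMod n)) (a b c d : ZMod n) : Prop :=
  IsEmptyCorner x a b ∧ IsEmptyCorner (x * Equiv.swap a b) c d

/-- The domain composed of two consecutive rectangles. -/
def chainDomain (x : Equiv.Perm (ZMod n)) (a b c d : ZMod n) : ZMod n → ZMod n → ℤ :=
  cornerRect x a b + cornerRect (x * Equiv.swap a b) c d

/-- The chains `(a, b, c, d)` and `(a', b', c', d')` decompose the same domain. -/
def IsRecut (x : Equiv.Perm (ZMod n)) (a b c d a' b' c' d' : ZMod n) : Prop :=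
  (IsEmptyChain x a b c d ↔ IsEmptyChain x a' b' c' d') ∧
    x * Equiv.swap a b * Equiv.swap c d = x * Equiv.swap a' b' * Equiv.swap c' d' ∧
    chainDomain x a b c d = chainDomain x a' b' c' d'

omit [NeZero n] in
theorem IsRecut.symm {x : Equiv.Perm (ZMod n)} {a b c d a' b' c' d' : ZMod n}
    (h : IsRecut x a b c d a' b' c' d') : IsRecut x a' b' c' d' a b c d :=
  ⟨h.1.symm, h.2.1.symm, h.2.2.symm⟩

theorem IsEmptyChain.cycLt_of_left {x : Equiv.Perm (ZMod n)} {a b d : ZMod n}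
    (h : IsEmptyChain x a b a d) (hd : d ≠ b) : CycLt (x a) (x b) (x d) := by
  obtain ⟨⟨hab, h1⟩, had, h2⟩ := h
  have h1 := h1 d
  have h2 := h2 b
  have t := cycLt_total hab hd.symm had
  have t' := cycLt_total (x.injective.ne hab) (x.injective.ne hd.symm) (x.injective.ne had)
  have r := @CycLt.rotate n
  have i := x.injective
  simp only [Equiv.Perm.mul_apply, Equiv.swap_apply_def] at h2
  grind

theorem IsEmptyChain.cycLt_of_mid {x : Equiv.Perm (ZMod n)} {a b d : ZMod n}
    (h : IsEmptyChain x a b b d) (hd : d ≠ a) : CycLt a b d := by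
  obtain ⟨⟨hab, h1⟩, hbd, h2⟩ := h
  have h1 := h1 d
  have h2 := h2 a
  have t := cycLt_total hab hbd hd.symm
  have t' := cycLt_total (x.injective.ne hab) (x.injective.ne hbd) (x.injective.ne hd.symm)
  have r := @CycLt.rotate n
  have i := x.injective
  simp only [Equiv.Perm.mul_apply, Equiv.swap_apply_def] at h2
  grind

theorem IsEmptyChain.cycLt_of_outer {x : Equiv.Perm (ZMod n)} {a b c : ZMod n}
    (h : IsEmptyChain x a b c a) (hc : c ≠ b) : CycLt c a b := by
  obtain ⟨⟨hab, h1⟩, hca, h2⟩ := h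
  have h1 := h1 c
  have h2 := h2 b
  have t := cycLt_total hab hc.symm hca.symm
  have t' := cycLt_total (x.injective.ne hab) (x.injective.ne hc.symm) (x.injective.ne hca.symm)
  have r := @CycLt.rotate n
  have i := x.injective
  simp only [Equiv.Perm.mul_apply, Equiv.swap_apply_def] at h2
  grind

theorem IsEmptyChain.cycLt_of_right {x : Equiv.Perm (ZMod n)} {a b c : ZMod n}
    (h : IsEmptyChain x a b c b) (hc : c ≠ a) : CycLt (x c) (x a) (x b) := by
  obtain ⟨⟨hab, h1⟩, hcb, h2⟩ := h
  have h1 := h1 c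
  have h2 := h2 a
  have t := cycLt_total hab hcb.symm hc.symm
  have t' := cycLt_total (x.injective.ne hab) (x.injective.ne hcb.symm) (x.injective.ne hc.symm)
  have r := @CycLt.rotate n
  have i := x.injective
  simp only [Equiv.Perm.mul_apply, Equiv.swap_apply_def] at h2
  grind

theorem isRecut_left_outer {x : Equiv.Perm (ZMod n)} {p q r : ZMod n}
    (hc : CycLt p q r) (hr : CycLt (x p) (x q) (x r)) : IsRecut x p q p r q r p q := by
  obtain ⟨n1, n2, n3⟩ := hc.ne
  refine ⟨?_, ?_, ?_⟩
  · have inj := x.injective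
    have ne := @CycLt.ne n
    have a1 := hr.asymm
    have a2 := hr.rotate.asymm
    have a3 := hr.rotate.rotate.asymm
    have a4 := hc.asymm
    have a5 := hc.rotate.asymm
    have a6 := hc.rotate.rotate.asymm
    have s := hc.split
    have s' := fun i ↦ hr.split (x i)
    simp only [IsEmptyChain, IsEmptyCorner, Equiv.Perm.mul_apply, Equiv.swap_apply_def]
    constructor <;> rintro ⟨⟨h1, h2⟩, h3, h4⟩ <;>
      refine ⟨⟨by grind, fun i ↦ ?_⟩, by grind, fun i ↦ ?_⟩ <;>
      specialize s i <;> specialize s' i <;> specialize h2 i <;> specialize h4 i <;> grind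
  · ext1 i
    simp only [Equiv.Perm.mul_apply, Equiv.swap_apply_def]
    grind
  · ext i j
    have s := arcInd_add hc i
    have s' := arcInd_add hr j
    simp only [chainDomain, Pi.add_apply, cornerRect, Equiv.Perm.mul_apply, Equiv.swap_apply_def]
    grind

theorem isRecut_left_mid {x : Equiv.Perm (ZMod n)} {p q r : ZMod n}
    (hc : CycLt p q r) (hr : CycLt (x p) (x r) (x q)) : IsRecut x p r p q p q q r := by
  obtain ⟨n1, n2, n3⟩ := hc.ne
  refine ⟨?_, ?_, ?_⟩
  · have inj := x.injective
    have ne := @CycLt.ne n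
    have a1 := hr.asymm
    have a2 := hr.rotate.asymm
    have a3 := hr.rotate.rotate.asymm
    have a4 := hc.asymm
    have a5 := hc.rotate.asymm
    have a6 := hc.rotate.rotate.asymm
    have s := hc.split
    have s' := fun i ↦ hr.split (x i)
    simp only [IsEmptyChain, IsEmptyCorner, Equiv.Perm.mul_apply, Equiv.swap_apply_def]
    constructor <;> rintro ⟨⟨h1, h2⟩, h3, h4⟩ <;>
      refine ⟨⟨by grind, fun i ↦ ?_⟩, by grind, fun i ↦ ?_⟩ <;>
      specialize s i <;> specialize s' i <;> specialize h2 i <;> specialize h4 i <;> grind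
  · ext1 i
    simp only [Equiv.Perm.mul_apply, Equiv.swap_apply_def]
    grind
  · ext i j
    have s := arcInd_add hc i
    have s' := arcInd_add hr j
    simp only [chainDomain, Pi.add_apply, cornerRect, Equiv.Perm.mul_apply, Equiv.swap_apply_def]
    grind

theorem isRecut_mid_right {x : Equiv.Perm (ZMod n)} {p q r : ZMod n}
    (hc : CycLt p q r) (hr : CycLt (x p) (x q) (x r)) : IsRecut x p q q r q r p r := by
  obtain ⟨n1, n2, n3⟩ := hc.ne
  refine ⟨?_, ?_, ?_⟩
  · have inj := x.injective
    have ne := @CycLt.ne n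
    have a1 := hr.asymm
    have a2 := hr.rotate.asymm
    have a3 := hr.rotate.rotate.asymm
    have a4 := hc.asymm
    have a5 := hc.rotate.asymm
    have a6 := hc.rotate.rotate.asymm
    have s := hc.split
    have s' := fun i ↦ hr.split (x i)
    simp only [IsEmptyChain, IsEmptyCorner, Equiv.Perm.mul_apply, Equiv.swap_apply_def]
    constructor <;> rintro ⟨⟨h1, h2⟩, h3, h4⟩ <;>
      refine ⟨⟨by grind, fun i ↦ ?_⟩, by grind, fun i ↦ ?_⟩ <;>
      specialize s i <;> specialize s' i <;> specialize h2 i <;> specialize h4 i <;> grind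
  · ext1 i
    simp only [Equiv.Perm.mul_apply, Equiv.swap_apply_def]
    grind
  · ext i j
    have s := arcInd_add hc i
    have s' := arcInd_add hr j
    simp only [chainDomain, Pi.add_apply, cornerRect, Equiv.Perm.mul_apply, Equiv.swap_apply_def]
    grind

theorem isRecut_outer_right {x : Equiv.Perm (ZMod n)} {p q r : ZMod n}
    (hc : CycLt p q r) (hr : CycLt (x q) (x p) (x r)) : IsRecut x q r p q p r q r := by
  obtain ⟨n1, n2, n3⟩ := hc.ne
  refine ⟨?_, ?_, ?_⟩
  · have inj := x.injective
    have ne := @CycLt.ne n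
    have a1 := hr.asymm
    have a2 := hr.rotate.asymm
    have a3 := hr.rotate.rotate.asymm
    have a4 := hc.asymm
    have a5 := hc.rotate.asymm
    have a6 := hc.rotate.rotate.asymm
    have s := hc.split
    have s' := fun i ↦ hr.split (x i)
    simp only [IsEmptyChain, IsEmptyCorner, Equiv.Perm.mul_apply, Equiv.swap_apply_def]
    constructor <;> rintro ⟨⟨h1, h2⟩, h3, h4⟩ <;>
      refine ⟨⟨by grind, fun i ↦ ?_⟩, by grind, fun i ↦ ?_⟩ <;>
      specialize s i <;> specialize s' i <;> specialize h2 i <;> specialize h4 i <;> grind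
  · ext1 i
    simp only [Equiv.Perm.mul_apply, Equiv.swap_apply_def]
    grind
  · ext i j
    have s := arcInd_add hc i
    have s' := arcInd_add hr j
    simp only [chainDomain, Pi.add_apply, cornerRect, Equiv.Perm.mul_apply, Equiv.swap_apply_def]
    grind

theorem IsEmptyChain.comm {x : Equiv.Perm (ZMod n)} {a b c d : ZMod n}
    (h : IsEmptyChain x a b c d) (hca : c ≠ a) (hcb : c ≠ b) (hda : d ≠ a) (hdb : d ≠ b) :
    IsEmptyChain x c d a b := by
  have inj := x.injective
  obtain ⟨⟨hab, h1⟩, hcd, h2⟩ := h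
  have sep := @CycLt.separate n _
  have c1 := @sep c a d b
  have c2 := @sep c b d a
  have c3 := @sep a c b d
  have c4 := @sep a d b c
  have r1 := @sep (x c) (x a) (x d) (x b)
  have r2 := @sep (x c) (x b) (x d) (x a)
  have r3 := @sep (x a) (x c) (x b) (x d)
  have r4 := @sep (x a) (x d) (x b) (x c)
  have n1 := inj.ne hca
  have n2 := inj.ne hcb
  have n3 := inj.ne hda
  have n4 := inj.ne hdb
  have e1 := h1 c
  have e2 := h1 d
  have e3 := h2 a
  have e4 := h2 b
  clear sep
  simp only [Equiv.Perm.mul_apply, Equiv.swap_apply_def] at h2 e3 e4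
  refine ⟨⟨hcd, fun i ↦ ?_⟩, hab, fun i ↦ ?_⟩ <;> specialize h1 i <;> specialize h2 i
  · grind
  · simp only [Equiv.Perm.mul_apply, Equiv.swap_apply_def]
    grind

theorem isRecut_disjoint {x : Equiv.Perm (ZMod n)} {a b c d : ZMod n}
    (hca : c ≠ a) (hcb : c ≠ b) (hda : d ≠ a) (hdb : d ≠ b) :
    IsRecut x a b c d c d a b := by
  refine ⟨⟨fun h ↦ h.comm hca hcb hda hdb,
    fun h ↦ h.comm hca.symm hda.symm hcb.symm hdb.symm⟩, ?_, ?_⟩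
  · ext1 i
    simp only [Equiv.Perm.mul_apply, Equiv.swap_apply_def]
    grind
  · ext i j
    simp only [chainDomain, Pi.add_apply, cornerRect, Equiv.Perm.mul_apply, Equiv.swap_apply_def]
    grind

/-- The alternative decomposition of the domain of a chain `t = ((a, b), (c, d))` of rectangles
starting at `x`, for `{a, b} ≠ {c, d}`. -/
def recut (x : Equiv.Perm (ZMod n)) (t : (ZMod n × ZMod n) × ZMod n × ZMod n) :
    (ZMod n × ZMod n) × ZMod n × ZMod n :=
  let (a, b) := t.1
  let (c, d) := t.2
  if c = a then
    if CycLt a b d then ((b, d), (a, b)) else ((a, d), (d, b))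
  else if c = b then
    if CycLt (x a) (x b) (x d) then ((b, d), (a, d)) else ((a, d), (a, b))
  else if d = a then
    if CycLt (x c) (x a) (x b) then ((c, a), (c, b)) else ((c, b), (a, b))
  else if d = b then
    if CycLt c a b then ((c, a), (a, b)) else ((c, b), (a, c))
  else ((c, d), (a, b))

theorem isRecut_recut_and {x : Equiv.Perm (ZMod n)} {a b c d : ZMod n}
    (h : IsEmptyChain x a b c d) (hv : ¬ (c = a ∧ d = b)) (hh : ¬ (c = b ∧ d = a)) :
    ∃ a' b' c' d', recut x ((a, b), (c, d)) = ((a', b'), (c', d')) ∧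
      IsRecut x a b c d a' b' c' d' ∧
      recut x ((a', b'), (c', d')) = ((a, b), (c, d)) ∧ (a', b') ≠ (a, b) := by
  have hab := h.1.1
  have hcd := h.2.1
  have inj := x.injective
  by_cases hca : c = a
  · subst hca
    have hdb : d ≠ b := by simpa using hv
    have hf := h.cycLt_of_left hdb
    by_cases hc : CycLt c b d
    · refine ⟨b, d, c, b, by simp [recut, hc], isRecut_left_outer hc hf, ?_, by grind⟩
      simp [recut, hf, hab, hcd]
    · have hc' := (cycLt_total hab hdb.symm hcd).resolve_left hc
      refine ⟨c, d, d, b, by simp [recut, hc], isRecut_left_mid hc' hf, ?_, by grind⟩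
      simp [recut, hf.asymm, hcd.symm]
  by_cases hcb : c = b
  · subst hcb
    have hda : d ≠ a := by simpa using hh
    have hc := h.cycLt_of_mid hda
    by_cases hf : CycLt (x a) (x c) (x d)
    · refine ⟨c, d, a, d, by simp [recut, hf, hca], isRecut_mid_right hc hf, ?_, by grind⟩
      simp [recut, hc, hab, hcd.symm, hda.symm]
    · have hf' := (cycLt_total (inj.ne hab) (inj.ne hcd) (inj.ne hda.symm)).resolve_left hf
      refine ⟨a, d, a, c, by simp [recut, hf, hca], (isRecut_left_mid hc hf').symm, ?_, by grind⟩
      simp [recut, hc.asymm]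
  by_cases hda : d = a
  · subst hda
    have hc := h.cycLt_of_outer hcb
    by_cases hf : CycLt (x c) (x d) (x b)
    · refine ⟨c, d, c, b, by simp [recut, hf, hca, hcb], (isRecut_left_outer hc hf).symm, ?_,
        by grind⟩
      simp [recut, hc]
    · have hf' := (cycLt_total (inj.ne hcd) (inj.ne hab) (inj.ne hcb)).resolve_left hf
      refine ⟨c, b, d, b, by simp [recut, hf, hca, hcb], isRecut_outer_right hc hf'.rotate.rotate,
        ?_, by grind⟩
      simp [recut, hc.rotate.asymm, hab, Ne.symm hca, Ne.symm hcb]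
  by_cases hdb : d = b
  · subst hdb
    have hf := h.cycLt_of_right hca
    by_cases hc : CycLt c a d
    · refine ⟨c, a, a, d, by simp [recut, hc, hca, hcb, hda], (isRecut_mid_right hc hf).symm, ?_,
        by grind⟩
      simp [recut, hf, Ne.symm hca]
    · have hc' := (cycLt_total hca hab hcb).resolve_left hc
      refine ⟨c, d, a, c, by simp [recut, hc, hca, hcb, hda],
        (isRecut_outer_right hc'.rotate.rotate hf.rotate.rotate.rotate).symm, ?_, by grind⟩
      simp [recut, hf.rotate.asymm, hab, Ne.symm hca]
  · refine ⟨c, d, a, b, by simp [recut, hca, hcb, hda, hdb], isRecut_disjoint hca hcb hda hdb, ?_,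
      by grind⟩
    simp [recut, Ne.symm hca, Ne.symm hcb, Ne.symm hda, Ne.symm hdb]

end Decompositions

section Maslov

variable {n : ℕ} [NeZero n]

theorem sum_sub_mul_add_eq_neg (f g : ZMod n → ℤ) :
    ∑ i, (f i - f (i - 1)) * (g i + g (i - 1)) =
      -∑ i, (f i + f (i - 1)) * (g i - g (i - 1)) := by
  have h : ∑ i, f (i - 1) * g (i - 1) = ∑ i, f i * g i :=
    Equiv.sum_comp (Equiv.subRight (1 : ZMod n)) fun i ↦ f i * g i
  rw [← sub_eq_zero, sub_neg_eq_add, ← Finset.sum_add_distrib]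
  calc _ = ∑ i, 2 * (f i * g i) - ∑ i, 2 * (f (i - 1) * g (i - 1)) := by
        rw [← Finset.sum_sub_distrib]
        exact Finset.sum_congr rfl fun i _ ↦ by ring
    _ = 0 := by rw [← Finset.mul_sum, ← Finset.mul_sum, h, sub_self]

/-- Four times the point measure. -/
def cornerSum (D : ZMod n → ZMod n → ℤ) (i j : ZMod n) : ℤ :=
  D i j + D (i - 1) j + D i (j - 1) + D (i - 1) (j - 1)

theorem sum_mixedDiff_mul_cornerSum_comm (R E : ZMod n → ZMod n → ℤ) :
    ∑ i, ∑ j, (R i j - R (i - 1) j - R i (j - 1) + R (i - 1) (j - 1)) * cornerSum E i j =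
      ∑ i, ∑ j, (E i j - E (i - 1) j - E i (j - 1) + E (i - 1) (j - 1)) * cornerSum R i j := by
  have h1 (i : ZMod n) := sum_sub_mul_add_eq_neg (fun j ↦ R i j - R (i - 1) j)
    (fun j ↦ E i j + E (i - 1) j)
  have h2 (j : ZMod n) := sum_sub_mul_add_eq_neg (fun i ↦ R i j + R i (j - 1))
    (fun i ↦ E i j - E i (j - 1))
  calc _ = ∑ i, ∑ j, ((R i j - R (i - 1) j) - (R i (j - 1) - R (i - 1) (j - 1))) *
          ((E i j + E (i - 1) j) + (E i (j - 1) + E (i - 1) (j - 1))) :=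
        Finset.sum_congr rfl fun i _ ↦ Finset.sum_congr rfl fun j _ ↦ by unfold cornerSum; ring
    _ = -∑ i, ∑ j, ((R i j - R (i - 1) j) + (R i (j - 1) - R (i - 1) (j - 1))) *
          ((E i j + E (i - 1) j) - (E i (j - 1) + E (i - 1) (j - 1))) := by
        rw [← Finset.sum_neg_distrib]
        exact Finset.sum_congr rfl fun i _ ↦ h1 i
    _ = -∑ j, ∑ i, ((R i j + R i (j - 1)) - (R (i - 1) j + R (i - 1) (j - 1))) *
          ((E i j - E i (j - 1)) + (E (i - 1) j - E (i - 1) (j - 1))) := by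
        rw [Finset.sum_comm]
        exact congrArg _ (Finset.sum_congr rfl fun i _ ↦ Finset.sum_congr rfl fun j _ ↦ by ring)
    _ = ∑ j, ∑ i, ((R i j + R i (j - 1)) + (R (i - 1) j + R (i - 1) (j - 1))) *
          ((E i j - E i (j - 1)) - (E (i - 1) j - E (i - 1) (j - 1))) := by
        rw [← Finset.sum_neg_distrib]
        exact Finset.sum_congr rfl fun j _ ↦ by rw [h2 j, neg_neg]
    _ = _ := by
        rw [Finset.sum_comm]
        exact Finset.sum_congr rfl fun i _ ↦ Finset.sum_congr rfl fun j _ ↦ by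
          unfold cornerSum; ring

theorem IsGridDomain.sum_mixedDiff_mul {x y : Equiv.Perm (ZMod n)} {D : ZMod n → ZMod n → ℤ}
    (h : IsGridDomain n x y D) (s : ZMod n → ZMod n → ℤ) :
    ∑ i, ∑ j, (D i j - D (i - 1) j - D i (j - 1) + D (i - 1) (j - 1)) * s i j =
      ∑ i, s i (x i) - ∑ i, s i (y i) := by
  rw [← Finset.sum_sub_distrib]
  refine Finset.sum_congr rfl fun i _ ↦ ?_
  simp [h i, sub_mul, Finset.sum_sub_distrib]

theorem IsGridDomain.sum_cornerSum_sub_comm {x w y z : Equiv.Perm (ZMod n)}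
    {R E : ZMod n → ZMod n → ℤ} (hR : IsGridDomain n x w R) (hE : IsGridDomain n y z E) :
    ∑ i, cornerSum E i (x i) - ∑ i, cornerSum E i (w i) =
      ∑ i, cornerSum R i (y i) - ∑ i, cornerSum R i (z i) := by
  rw [← hR.sum_mixedDiff_mul, ← hE.sum_mixedDiff_mul, sum_mixedDiff_mul_cornerSum_comm]

omit [NeZero n] in
theorem cornerSum_add (R E : ZMod n → ZMod n → ℤ) (i j : ZMod n) :
    cornerSum (R + E) i j = cornerSum R i j + cornerSum E i j := by
  simp only [cornerSum, Pi.add_apply]; ring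

theorem maslov_eq (x y : Equiv.Perm (ZMod n)) (D : ZMod n → ZMod n → ℤ) :
    maslov n x y D = ((∑ i, cornerSum D i (x i) + ∑ i, cornerSum D i (y i) : ℤ) : ℚ) / 4 := by
  simp only [maslov, ptMeasure, ← Finset.sum_div, ← add_div, cornerSum]
  push_cast
  rfl

theorem cornerSum_cornerRect {x : Equiv.Perm (ZMod n)} {a b : ZMod n} (hab : a ≠ b)
    (i j : ZMod n) : cornerSum (cornerRect x a b) i j =
      (2 * (if CycLt a i b then 1 else 0) + (if i = a then 1 else 0) + if i = b then 1 else 0) *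
      (2 * (if CycLt (x a) j (x b) then 1 else 0) + (if j = x a then 1 else 0) +
        if j = x b then 1 else 0) := by
  rw [← arcInd_add_arcInd hab, ← arcInd_add_arcInd (x.injective.ne hab)]
  unfold cornerSum cornerRect; ring

theorem IsEmptyRectangle.sum_cornerSum {x w : Equiv.Perm (ZMod n)} {R : ZMod n → ZMod n → ℤ}
    (h : IsEmptyRectangle n x w R) :
    ∑ i, cornerSum R i (x i) = 2 ∧ ∑ i, cornerSum R i (w i) = 2 := by
  obtain ⟨a, b, ⟨hab, he⟩, rfl, rfl⟩ := isEmptyRectangle_iff.1 h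
  have inj := x.injective
  have ne := @CycLt.ne n
  have hsum : ∑ i, ((if i = a then 1 else 0) + if i = b then 1 else 0 : ℤ) = 2 := by
    simp [Finset.sum_add_distrib]
  constructor <;> rw [← hsum] <;> refine Finset.sum_congr rfl fun i _ ↦ ?_ <;>
    rw [cornerSum_cornerRect hab] <;> specialize he i
  · grind
  · simp only [Equiv.Perm.mul_apply, Equiv.swap_apply_def]
    grind

theorem maslov_add_of_isEmptyRectangle_left {x w y : Equiv.Perm (ZMod n)}
    {R E : ZMod n → ZMod n → ℤ} (hR : IsEmptyRectangle n x w R) (hE : IsGridDomain n w y E) :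
    maslov n x y (R + E) = maslov n w y E + 1 := by
  have h := hR.1.1.sum_cornerSum_sub_comm hE
  obtain ⟨h1, h2⟩ := hR.sum_cornerSum
  simp only [maslov_eq, cornerSum_add, Finset.sum_add_distrib]
  rw [div_add_one (by norm_num)]
  congr 1
  norm_cast
  linarith

theorem maslov_add_of_isEmptyRectangle_right {x w y : Equiv.Perm (ZMod n)}
    {R E : ZMod n → ZMod n → ℤ} (hR : IsEmptyRectangle n w y R) (hE : IsGridDomain n x w E) :
    maslov n x y (R + E) = maslov n x w E + 1 := by
  have h := hR.1.1.sum_cornerSum_sub_comm hE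
  obtain ⟨h1, h2⟩ := hR.sum_cornerSum
  simp only [maslov_eq, cornerSum_add, Finset.sum_add_distrib]
  rw [div_add_one (by norm_num)]
  congr 1
  norm_cast
  linarith

end Maslov

section DifferentialMatrix

variable {n : ℕ} [NeZero n]

/-- The group algebra over `𝔽₂` of the group of functions on the squares of the grid. -/
abbrev GridAlgebra (n : ℕ) := AddMonoidAlgebra (ZMod 2) (ZMod n → ZMod n → ℤ)

/-- The monomial of a function on the squares of the grid. -/
noncomputable def gridMonomial (D : ZMod n → ZMod n → ℤ) : GridAlgebra n :=
  AddMonoidAlgebra.single D 1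

omit [NeZero n] in
theorem gridMonomial_mul (D E : ZMod n → ZMod n → ℤ) :
    gridMonomial D * gridMonomial E = gridMonomial (D + E) := by
  simp [gridMonomial, AddMonoidAlgebra.single_mul_single]

open scoped Classical in
/-- The matrix whose entry at `(x, w)` is the sum of the inverse monomials of the empty rectangles
from `x` to `w`. -/
noncomputable def rectMatrix (n : ℕ) [NeZero n] :
    Matrix (Equiv.Perm (ZMod n)) (Equiv.Perm (ZMod n)) (GridAlgebra n) := fun x w ↦
  ∑ p : ZMod n × ZMod n, if IsEmptyCorner x p.1 p.2 ∧ w = x * Equiv.swap p.1 p.2 then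
    gridMonomial (-cornerRect x p.1 p.2) else 0

theorem GridAlgebra.add_self {n : ℕ} (f : GridAlgebra n) : f + f = 0 := by
  rw [← two_smul (ZMod 2), show (2 : ZMod 2) = 0 from rfl, zero_smul]

open scoped Classical in
theorem coeff_rectMatrix (x w : Equiv.Perm (ZMod n)) (K : ZMod n → ZMod n → ℤ) :
    (rectMatrix n x w).coeff K = if IsEmptyRectangle n x w (-K) then 1 else 0 := by
  have hcoeff : (rectMatrix n x w).coeff K = ∑ p : ZMod n × ZMod n,
      if (IsEmptyCorner x p.1 p.2 ∧ w = x * Equiv.swap p.1 p.2) ∧ -K = cornerRect x p.1 p.2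
        then 1 else 0 := by
    simp only [rectMatrix, AddMonoidAlgebra.coeff_sum, Finsupp.finsetSum_apply]
    refine Finset.sum_congr rfl fun p _ ↦ ?_
    by_cases h : IsEmptyCorner x p.1 p.2 ∧ w = x * Equiv.swap p.1 p.2
    · simp [h, gridMonomial, Finsupp.single_apply, neg_eq_iff_eq_neg, @eq_comm _ K]
    · simp [h]
  rw [hcoeff]
  split_ifs with h
  · obtain ⟨a, b, hab, hw, hK⟩ := isEmptyRectangle_iff.1 h
    rw [Finset.sum_eq_single (a, b)]
    · simp [hab, hw, hK]
    · rintro ⟨c, d⟩ - hne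
      rw [if_neg]
      rintro ⟨⟨hcd, -⟩, hK'⟩
      obtain ⟨rfl, rfl⟩ := cornerRect_injective hcd.1 hab.1 (hK'.symm.trans hK)
      exact hne rfl
    · simp
  · refine Finset.sum_eq_zero fun p _ ↦ if_neg fun hp ↦ h ?_
    exact isEmptyRectangle_iff.2 ⟨p.1, p.2, hp.1.1, hp.1.2, hp.2⟩

open scoped Classical in
theorem rectMatrix_mul_self_apply (x z : Equiv.Perm (ZMod n)) :
    (rectMatrix n * rectMatrix n) x z = ∑ p : ZMod n × ZMod n, ∑ q : ZMod n × ZMod n,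
      if IsEmptyChain x p.1 p.2 q.1 q.2 ∧ z = x * Equiv.swap p.1 p.2 * Equiv.swap q.1 q.2 then
        gridMonomial (-chainDomain x p.1 p.2 q.1 q.2) else 0 := by
  simp only [Matrix.mul_apply, rectMatrix, Finset.sum_mul_sum]
  rw [Finset.sum_comm]
  refine Finset.sum_congr rfl fun p _ ↦ ?_
  rw [Finset.sum_comm]
  refine Finset.sum_congr rfl fun q _ ↦ ?_
  rw [Finset.sum_eq_single (x * Equiv.swap p.1 p.2)]
  · have hc : -chainDomain x p.1 p.2 q.1 q.2 =
        -cornerRect x p.1 p.2 + -cornerRect (x * Equiv.swap p.1 p.2) q.1 q.2 := neg_add _ _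
    simp only [hc, ← gridMonomial_mul, IsEmptyChain]
    split_ifs <;> simp_all
  · intro w _ hw
    simp [hw]
  · simp

open scoped Classical in
theorem rectMatrix_mul_self_apply_ne {x z : Equiv.Perm (ZMod n)} (hxz : x ≠ z) :
    (rectMatrix n * rectMatrix n) x z = 0 := by
  rw [rectMatrix_mul_self_apply, ← Fintype.sum_prod_type', ← Finset.sum_filter]
  have key : ∀ t ∈ Finset.univ.filter fun t : (ZMod n × ZMod n) × ZMod n × ZMod n ↦
      IsEmptyChain x t.1.1 t.1.2 t.2.1 t.2.2 ∧
        z = x * Equiv.swap t.1.1 t.1.2 * Equiv.swap t.2.1 t.2.2,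
      ∃ a' b' c' d', recut x t = ((a', b'), (c', d')) ∧
        IsRecut x t.1.1 t.1.2 t.2.1 t.2.2 a' b' c' d' ∧
        recut x ((a', b'), (c', d')) = t ∧ (a', b') ≠ t.1 := by
    rintro ⟨⟨a, b⟩, c, d⟩ ht
    obtain ⟨ht, hz⟩ := (Finset.mem_filter.1 ht).2
    refine isRecut_recut_and ht ?_ ?_
    · rintro ⟨rfl, rfl⟩
      simp [mul_assoc] at hz
      exact hxz hz.symm
    · rintro ⟨rfl, rfl⟩
      simp [mul_assoc, Equiv.swap_comm d c] at hz
      exact hxz hz.symm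
  refine Finset.sum_involution (fun t _ ↦ recut x t) ?_ ?_ ?_ ?_
  · intro t ht
    obtain ⟨a', b', c', d', h1, h2, -⟩ := key t ht
    rw [h1, h2.2.2]
    exact GridAlgebra.add_self _
  · intro t ht _ h
    obtain ⟨a', b', c', d', h1, -, -, h4⟩ := key t ht
    exact h4 (by rw [← h, h1])
  · intro t ht
    obtain ⟨a', b', c', d', h1, h2, -⟩ := key t ht
    have ht' := (Finset.mem_filter.1 ht).2
    rw [h1]
    exact Finset.mem_filter.2 ⟨Finset.mem_univ _, h2.1.1 ht'.1, ht'.2.trans h2.2.1⟩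
  · intro t ht
    obtain ⟨a', b', c', d', h1, -, h3, -⟩ := key t ht
    simp only [h1, h3]

/-- The sum of the inverse monomials of the thin annuli. -/
noncomputable def annulusSum (n : ℕ) [NeZero n] : GridAlgebra n :=
  ∑ a : ZMod n, gridMonomial (fun i _ ↦ -arcInd a (a + 1) i) +
    ∑ a : ZMod n, gridMonomial (fun _ j ↦ -arcInd a (a + 1) j)

theorem not_cycLt_add_one (hn : 2 ≤ n) (a i : ZMod n) : ¬ CycLt a i (a + 1) := by
  have : Fact (1 < n) := ⟨hn⟩
  intro h
  have h' := (mem_arc_iff (by simp) i).1 (Or.inr h)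
  rw [add_sub_cancel_left, ZMod.val_one, Nat.lt_one_iff, ZMod.val_eq_zero, sub_eq_zero] at h'
  exact h.ne.1 h'.symm

theorem cycLt_add_one {a b : ZMod n} (hab : a ≠ b) (hb : b ≠ a + 1) : CycLt a (a + 1) b := by
  have : Fact (1 < n) := ⟨two_le_of_ne hab⟩
  refine ((mem_arc_iff hab _).2 ?_).resolve_left (by simp)
  have h0 : (b - a).val ≠ 0 := by
    rw [Ne, ZMod.val_eq_zero, sub_eq_zero]; exact hab.symm
  have h1 : (b - a).val ≠ 1 := by
    intro h
    rw [← ZMod.val_one n] at h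
    exact hb (by rw [← ZMod.val_injective n h]; ring)
  rw [add_sub_cancel_left, ZMod.val_one]
  omega

theorem isEmptyChain_vertical_iff (hn : 2 ≤ n) {x : Equiv.Perm (ZMod n)} {a b : ZMod n} :
    IsEmptyChain x a b a b ↔ b = a + 1 := by
  have : Fact (1 < n) := ⟨hn⟩
  simp only [IsEmptyChain, IsEmptyCorner, Equiv.Perm.mul_apply, Equiv.swap_apply_left,
    Equiv.swap_apply_right]
  constructor
  · rintro ⟨⟨hab, h1⟩, -, h2⟩
    by_contra hb
    have hc := cycLt_add_one hab hb
    have h1 := h1 _ hc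
    have h2 := h2 _ hc
    obtain ⟨n1, n2, -⟩ := hc.ne
    rw [Equiv.swap_apply_of_ne_of_ne n1.symm n2] at h2
    rcases cycLt_total (x.injective.ne n1) (x.injective.ne n2) (x.injective.ne hab) with h | h
    · exact h1 h
    · exact h2 h.rotate
  · rintro rfl
    simp [not_cycLt_add_one hn]

theorem isEmptyChain_horizontal_iff (hn : 2 ≤ n) {x : Equiv.Perm (ZMod n)} {a b : ZMod n} :
    IsEmptyChain x a b b a ↔ x b = x a + 1 := by
  have : Fact (1 < n) := ⟨hn⟩
  simp only [IsEmptyChain, IsEmptyCorner, Equiv.Perm.mul_apply, Equiv.swap_apply_left,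
    Equiv.swap_apply_right]
  constructor
  · rintro ⟨⟨hab, h1⟩, -, h2⟩
    by_contra hb
    have hc := cycLt_add_one (x.injective.ne hab) hb
    obtain ⟨i, hi⟩ := x.surjective (x a + 1)
    rw [← hi] at hc
    obtain ⟨n1, n2, -⟩ := hc.ne
    have n1 : a ≠ i := fun h ↦ n1 (congrArg x h)
    have n2 : i ≠ b := fun h ↦ n2 (congrArg x h)
    rcases cycLt_total n1 n2 hab with h | h
    · exact h1 i h hc
    · refine h2 i h.rotate ?_
      rwa [Equiv.swap_apply_of_ne_of_ne n1.symm n2]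
  · intro hb
    have hab : a ≠ b := by
      rintro rfl
      simp at hb
    simp [hb, hab, hab.symm, not_cycLt_add_one hn]

theorem chainDomain_vertical {x : Equiv.Perm (ZMod n)} {a b : ZMod n} (hab : a ≠ b) :
    chainDomain x a b a b = fun i _ ↦ arcInd a b i := by
  ext i j
  have h := arcInd_add_symm (x.injective.ne hab) j
  simp only [chainDomain, cornerRect, Pi.add_apply, Equiv.Perm.mul_apply, Equiv.swap_apply_left,
    Equiv.swap_apply_right]
  rw [← mul_add, h, mul_one]

theorem chainDomain_horizontal {x : Equiv.Perm (ZMod n)} {a b : ZMod n} (hab : a ≠ b) :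
    chainDomain x a b b a = fun _ j ↦ arcInd (x a) (x b) j := by
  ext i j
  have h := arcInd_add_symm hab i
  simp only [chainDomain, cornerRect, Pi.add_apply, Equiv.Perm.mul_apply, Equiv.swap_apply_left,
    Equiv.swap_apply_right]
  rw [← add_mul, h, one_mul]

open scoped Classical in
theorem closedChain_term (hn : 2 ≤ n) (x : Equiv.Perm (ZMod n)) (a b c d : ZMod n) :
    (if IsEmptyChain x a b c d ∧ x = x * Equiv.swap a b * Equiv.swap c d then
      gridMonomial (-chainDomain x a b c d) else 0) =
    (if (c, d) = (a, b) then if b = a + 1 then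
      gridMonomial (fun i _ ↦ -arcInd a (a + 1) i) else 0 else 0) +
    if (c, d) = (b, a) then if x b = x a + 1 then
      gridMonomial (fun _ j ↦ -arcInd (x a) (x a + 1) j) else 0 else 0 := by
  have : Fact (1 < n) := ⟨hn⟩
  by_cases hab : a = b
  · subst hab
    have h1 : ¬ IsEmptyChain x a a c d := fun h ↦ h.1.1 rfl
    simp [h1]
  by_cases hv : (c, d) = (a, b)
  · obtain ⟨rfl, rfl⟩ := Prod.mk.inj hv
    have hh : (c, d) ≠ (d, c) := by simp [hab]
    rw [if_neg hh, isEmptyChain_vertical_iff hn, chainDomain_vertical hab]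
    by_cases hb : d = c + 1
    · subst hb
      simp [mul_assoc]
      rfl
    · simp [hb]
  by_cases hh : (c, d) = (b, a)
  · obtain ⟨rfl, rfl⟩ := Prod.mk.inj hh
    rw [if_neg hv, isEmptyChain_horizontal_iff hn, chainDomain_horizontal hab]
    by_cases hb : x c = x d + 1
    · rw [hb]
      simp [mul_assoc, Equiv.swap_comm d c]
      rfl
    · simp [hb]
  rw [if_neg, if_neg hv, if_neg hh, add_zero]
  rintro ⟨h, hx⟩
  rw [mul_assoc, left_eq_mul] at hx
  have ha := congrArg (fun f ↦ f c) hx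
  have hb := congrArg (fun f ↦ f d) hx
  have hcd := h.2.1
  simp only [Equiv.Perm.mul_apply, Equiv.swap_apply_left, Equiv.swap_apply_right,
    Equiv.Perm.one_apply, Equiv.swap_apply_def] at ha hb
  grind

theorem rectMatrix_mul_self (hn : 2 ≤ n) :
    rectMatrix n * rectMatrix n = Matrix.scalar _ (annulusSum n) := by
  classical
  ext1 x z
  by_cases hxz : x = z
  · subst hxz
    rw [rectMatrix_mul_self_apply]
    have hterm (p q : ZMod n × ZMod n) := closedChain_term hn x p.1 p.2 q.1 q.2
    simp only [Prod.mk.eta] at hterm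
    simp only [hterm, Finset.sum_add_distrib, Finset.sum_ite_eq',
      Finset.mem_univ, if_true, Fintype.sum_prod_type, Matrix.scalar_apply,
      Matrix.diagonal_apply_eq, annulusSum]
    congr 1
    rw [← Equiv.sum_comp x fun a ↦ gridMonomial fun _ j ↦ -arcInd a (a + 1) j]
    refine Finset.sum_congr rfl fun a _ ↦ ?_
    rw [Finset.sum_eq_single (x.symm (x a + 1))]
    · simp
    · intro b _ hb
      exact if_neg fun h ↦ hb (by rw [← h, Equiv.symm_apply_apply])
    · simp
  · rw [rectMatrix_mul_self_apply_ne hxz]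
    simp [hxz]

end DifferentialMatrix

section ObstructionComplex

variable {n : ℕ}

theorem IsGridDomain.add {x w y : Equiv.Perm (ZMod n)} {R E : ZMod n → ZMod n → ℤ}
    (hR : IsGridDomain n x w R) (hE : IsGridDomain n w y E) : IsGridDomain n x y (R + E) := by
  intro i j
  have h1 := hR i j
  have h2 := hE i j
  simp only [Pi.add_apply]
  linarith

theorem ObGen.ext_of_eq {t g : ObGen n} (hx : t.x = g.x) (hy : t.y = g.y) (hD : t.D = g.D) :
    t = g := by
  cases t; cases g; subst hx hy hD; rfl

variable [NeZero n]

theorem IsEmptyRectangle.nonneg {x w : Equiv.Perm (ZMod n)} {R : ZMod n → ZMod n → ℤ}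
    (h : IsEmptyRectangle n x w R) (i j : ZMod n) : 0 ≤ R i j := by
  obtain ⟨a, b, -, -, rfl⟩ := isEmptyRectangle_iff.1 h
  exact cornerRect_nonneg x a b i j

/-- Matrices indexed by the grid states, over the group algebra of functions on the squares. -/
abbrev GridMatrix (n : ℕ) := Matrix (Equiv.Perm (ZMod n)) (Equiv.Perm (ZMod n)) (GridAlgebra n)

/-- The anticommutator with the transposed matrix of empty rectangles. -/
noncomputable def matrixBd (n : ℕ) [NeZero n] : GridMatrix n →ₗ[ZMod 2] GridMatrix n :=
  LinearMap.mulLeft (ZMod 2) (rectMatrix n).transpose +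
    LinearMap.mulRight (ZMod 2) (rectMatrix n).transpose

theorem matrixBd_apply (X : GridMatrix n) :
    matrixBd n X = (rectMatrix n).transpose * X + X * (rectMatrix n).transpose := rfl

theorem matrixBd_matrixBd (hn : 2 ≤ n) (X : GridMatrix n) : matrixBd n (matrixBd n X) = 0 := by
  have hself (Y : GridMatrix n) : Y + Y = 0 := by
    ext1 x y
    exact GridAlgebra.add_self _
  have hM : (rectMatrix n).transpose * (rectMatrix n).transpose =
      Matrix.scalar _ (annulusSum n) := by
    rw [← Matrix.transpose_mul, rectMatrix_mul_self hn]
    simp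
  have hcomm : Matrix.scalar _ (annulusSum n) * X = X * Matrix.scalar _ (annulusSum n) :=
    Matrix.scalar_commute _ (fun _ ↦ Commute.all _ _) X
  simp only [matrixBd_apply, mul_add, add_mul]
  rw [← mul_assoc, hM, mul_assoc X, hM, hcomm, mul_assoc, add_comm (_ * _), hself]

/-- The matrix of a chain of the obstruction complex. -/
noncomputable def toGridMatrix (n : ℕ) [NeZero n] : (ObGen n →₀ ZMod 2) →ₗ[ZMod 2] GridMatrix n :=
  Finsupp.linearCombination (ZMod 2) fun t ↦ Matrix.single t.x t.y (gridMonomial t.D)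

/-- The chain of the obstruction complex with coefficients read off from a matrix. -/
noncomputable def ofGridMatrix (n : ℕ) [NeZero n] : GridMatrix n →ₗ[ZMod 2] (ObGen n →₀ ZMod 2) where
  toFun X := Finsupp.ofSupportFinite (fun g ↦ (X g.x g.y).coeff g.D) <| by
    have hfin : (⋃ p : Equiv.Perm (ZMod n) × Equiv.Perm (ZMod n),
        (fun D ↦ (p.1, p.2, D)) '' ((X p.1 p.2).coeff.support : Set (ZMod n → ZMod n → ℤ))).Finite :=
      Set.finite_iUnion fun p ↦ (Finset.finite_toSet _).image _
    refine (hfin.preimage (f := fun g : ObGen n ↦ (g.x, g.y, g.D)) ?_).subset ?_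
    · intro t _ g _ h
      simp only [Prod.mk.injEq] at h
      exact ObGen.ext_of_eq h.1 h.2.1 h.2.2
    · intro g hg
      exact Set.mem_iUnion.2 ⟨(g.x, g.y), g.D, Finsupp.mem_support_iff.2 hg, rfl⟩
  map_add' X Y := by ext g; simp [Finsupp.ofSupportFinite_coe]
  map_smul' c X := by ext g; simp [Finsupp.ofSupportFinite_coe]

theorem ofGridMatrix_apply (X : GridMatrix n) (g : ObGen n) :
    ofGridMatrix n X g = (X g.x g.y).coeff g.D := rfl

theorem ofGridMatrix_toGridMatrix (f : ObGen n →₀ ZMod 2) :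
    ofGridMatrix n (toGridMatrix n f) = f := by
  classical
  suffices h : ofGridMatrix n ∘ₗ toGridMatrix n = LinearMap.id from LinearMap.congr_fun h f
  refine Finsupp.lhom_ext' fun t ↦ LinearMap.ext_ring ?_
  ext g
  simp only [LinearMap.comp_apply, Finsupp.lsingle_apply, toGridMatrix,
    Finsupp.linearCombination_single, one_smul, ofGridMatrix_apply, LinearMap.id_apply,
    Matrix.single_apply, Finsupp.single_apply]
  by_cases hx : t.x = g.x ∧ t.y = g.y
  · by_cases hD : t.D = g.D
    · rw [if_pos hx, if_pos (ObGen.ext_of_eq hx.1 hx.2 hD), gridMonomial]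
      simp [hD]
    · have : t ≠ g := by rintro rfl; exact hD rfl
      rw [if_pos hx, if_neg this, gridMonomial]
      simp [hD]
  · have : t ≠ g := by rintro rfl; exact hx ⟨rfl, rfl⟩
    rw [if_neg hx, if_neg this]
    simp

theorem ofGridMatrix_matrixBd_eq_zero {X : GridMatrix n} (hX : ofGridMatrix n X = 0) :
    ofGridMatrix n (matrixBd n X) = 0 := by
  classical
  have hX' {x y : Equiv.Perm (ZMod n)} {D : ZMod n → ZMod n → ℤ} (h : IsGridDomain n x y D)
      (hD : ∀ i j, 0 ≤ D i j) : (X x y).coeff D = 0 :=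
    DFunLike.congr_fun hX ⟨x, y, D, h, hD⟩
  ext g
  simp only [ofGridMatrix_apply, matrixBd_apply, Matrix.add_apply, Matrix.mul_apply,
    Matrix.transpose_apply, AddMonoidAlgebra.coeff_add, AddMonoidAlgebra.coeff_sum,
    Finsupp.add_apply, Finsupp.finsetSum_apply, Finsupp.coe_zero, Pi.zero_apply]
  rw [Finset.sum_eq_zero, Finset.sum_eq_zero, add_zero]
  · intro w _
    rw [AddMonoidAlgebra.coeff_mul_apply_right]
    refine Finset.sum_eq_zero fun K hK ↦ ?_
    rw [Finsupp.mem_support_iff, coeff_rectMatrix] at hK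
    have hR : IsEmptyRectangle n g.y w (-K) := by by_contra h; simp [h] at hK
    dsimp only
    rw [hX' (g.isDomain.add hR.1.1) fun i j ↦ add_nonneg (g.pos i j) (hR.nonneg i j), zero_mul]
  · intro w _
    rw [AddMonoidAlgebra.coeff_mul_apply_left]
    refine Finset.sum_eq_zero fun K hK ↦ ?_
    rw [Finsupp.mem_support_iff, coeff_rectMatrix] at hK
    have hR : IsEmptyRectangle n w g.x (-K) := by by_contra h; simp [h] at hK
    dsimp only
    rw [hX' (hR.1.1.add g.isDomain) fun i j ↦ add_nonneg (hR.nonneg i j) (g.pos i j), mul_zero]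

/-- The differential of the obstruction complex. -/
noncomputable def obBd (n : ℕ) [NeZero n] : (ObGen n →₀ ZMod 2) →ₗ[ZMod 2] (ObGen n →₀ ZMod 2) :=
  ofGridMatrix n ∘ₗ matrixBd n ∘ₗ toGridMatrix n

theorem obBd_obBd (hn : 2 ≤ n) (f : ObGen n →₀ ZMod 2) : obBd n (obBd n f) = 0 := by
  have h : ofGridMatrix n (matrixBd n (toGridMatrix n (obBd n f) -
      matrixBd n (toGridMatrix n f))) = 0 :=
    ofGridMatrix_matrixBd_eq_zero (by rw [map_sub, ofGridMatrix_toGridMatrix]; exact sub_self _)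
  rwa [map_sub, matrixBd_matrixBd hn, sub_zero] at h

open scoped Classical in
theorem obBd_single_apply (t g : ObGen n) :
    obBd n (Finsupp.single t 1) g =
      (if g.y = t.y ∧ IsEmptyRectangle n t.x g.x (fun i j ↦ t.D i j - g.D i j) then 1 else 0) +
      (if g.x = t.x ∧ IsEmptyRectangle n g.y t.y (fun i j ↦ t.D i j - g.D i j) then 1 else 0) := by
  have hD : -(g.D - t.D) = fun i j ↦ t.D i j - g.D i j := neg_sub _ _
  simp only [obBd, LinearMap.comp_apply, toGridMatrix, Finsupp.linearCombination_single, one_smul,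
    ofGridMatrix_apply, matrixBd_apply, Matrix.add_apply, AddMonoidAlgebra.coeff_add,
    Finsupp.add_apply]
  congr 1
  · by_cases hy : g.y = t.y
    · rw [hy, Matrix.mul_single_apply_same, gridMonomial, AddMonoidAlgebra.coeff_mul_single_apply,
        mul_one, Matrix.transpose_apply, coeff_rectMatrix, ← sub_eq_add_neg, hD]
      simp
    · rw [Matrix.mul_single_apply_of_ne _ _ _ _ _ hy]
      simp [hy]
  · by_cases hx : g.x = t.x
    · rw [hx, Matrix.single_mul_apply_same, gridMonomial, AddMonoidAlgebra.coeff_single_mul_apply,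
        one_mul, Matrix.transpose_apply, coeff_rectMatrix, neg_add_eq_sub, hD]
      simp
    · rw [Matrix.single_mul_apply_of_ne _ _ _ _ _ hx]
      simp [hx]

theorem maslov_of_obBd_single_apply_ne_zero {t g : ObGen n}
    (h : obBd n (Finsupp.single t 1) g ≠ 0) :
    maslov n g.x g.y g.D = maslov n t.x t.y t.D - 1 := by
  classical
  have hD : t.D = (fun i j ↦ t.D i j - g.D i j) + g.D := (sub_add_cancel t.D g.D).symm
  rw [obBd_single_apply] at h
  rw [hD, eq_sub_iff_add_eq]
  by_cases h1 : g.y = t.y ∧ IsEmptyRectangle n t.x g.x (fun i j ↦ t.D i j - g.D i j)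
  · rw [← h1.1, maslov_add_of_isEmptyRectangle_left h1.2 g.isDomain]
  · by_cases h2 : g.x = t.x ∧ IsEmptyRectangle n g.y t.y (fun i j ↦ t.D i j - g.D i j)
    · rw [← h2.1, maslov_add_of_isEmptyRectangle_right h2.2 g.isDomain]
    · simp [h1, h2] at h

theorem maslov_of_mem_support_obBd {k : ℚ} {f : ObGen n →₀ ZMod 2}
    (hf : ∀ t ∈ f.support, maslov n t.x t.y t.D = k) {g : ObGen n}
    (hg : g ∈ (obBd n f).support) : maslov n g.x g.y g.D = k - 1 := by
  have hsum : obBd n f g = ∑ t ∈ f.support, f t * obBd n (Finsupp.single t 1) g := by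
    conv_lhs => rw [← f.sum_single, map_finsuppSum, Finsupp.sum, Finsupp.finsetSum_apply]
    refine Finset.sum_congr rfl fun t _ ↦ ?_
    rw [← mul_one (f t), ← smul_eq_mul, ← Finsupp.smul_single, map_smul]
    simp
  rw [Finsupp.mem_support_iff, hsum] at hg
  obtain ⟨t, ht, htg⟩ := Finset.exists_ne_zero_of_sum_ne_zero hg
  rw [maslov_of_obBd_single_apply_ne_zero (right_ne_zero_of_mul htg), hf t ht]

end ObstructionComplex

open scoped Classical in
/-- The obstruction complex of a grid is a chain complex over `𝔽₂`:
on the `𝔽₂`-vector space with basis the triples `(x, y, D)` (`D` a positive domain from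
`x` to `y`, graded by the Maslov index `μ(D)`), the linear map `∂` sending a generator
`(x, y, D)` to `Σ (w, y, E) + Σ (x, w, E)` — the first sum over triples `(w, R, E)`
with `R` an empty rectangle from `x` to `w`, `E` a positive domain from `w` to `y` and
`R + E = D`, the second over triples `(w, E, R)` with `E` a positive domain from `x` to
`w`, `R` an empty rectangle from `w` to `y` and `E + R = D` — is well defined
(equivalently: its coefficients are as in the formula below, since for each generator
`g` there is at most one such triple of each kind), maps the degree-`k` part to the
degree-`(k-1)` part, and satisfies `∂ ∘ ∂ = 0`. -/
theorem stmt_14 (n : ℕ) [NeZero n] (hn : 2 ≤ n) :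
    ∃ bd : (ObGen n →₀ ZMod 2) →ₗ[ZMod 2] (ObGen n →₀ ZMod 2),
      (∀ t g : ObGen n,
        bd (Finsupp.single t 1) g =
          (if g.y = t.y ∧
              IsEmptyRectangle n t.x g.x (fun i j => t.D i j - g.D i j) then 1 else 0) +
          (if g.x = t.x ∧
              IsEmptyRectangle n g.y t.y (fun i j => t.D i j - g.D i j) then 1 else 0)) ∧
      (∀ (k : ℚ) (f : ObGen n →₀ ZMod 2),
        (∀ t ∈ f.support, maslov n t.x t.y t.D = k) →
        ∀ g ∈ (bd f).support, maslov n g.x g.y g.D = k - 1) ∧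
      (∀ f : ObGen n →₀ ZMod 2, bd (bd f) = 0) := by
  exact ⟨obBd n, obBd_single_apply, fun k f hf g hg ↦ maslov_of_mem_support_obBd hf hg,
    obBd_obBd hn⟩
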